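/- arXiv:2207.13041 — 2 statements merged into one kernel-verified Lean document; each statement's English description precedes it below -/
import Mathlib

section
/- Let n ≥ 1 and let α = (a_1,…,a_n) be an MVP parking function with O_n(α) = w_0. Then for every i ∈ [n], among the spots 1,…,i, the number of spots preferred by at least two cars is at least the number of spots preferred by no car: |{j ≤ i : m_j(α) ≥ 2}| ≥ |{j ≤ i : m_j(α) = 0}|. -/
open Finset

namespace MVPPark

/-- One step of the MVP parking process: car `c`, preferring spot `p`, arrives at the
state `state` (recording, for each spot, the car parked there, if any).  Car `c` always
parks in spot `p`; if spot `p` was occupied by an (earlier) car `j`, then `j` is bumped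
and parks in the first unoccupied spot strictly beyond `p`, if such a spot exists
(otherwise `j` drives off unparked). -/
def mvpStep {n : ℕ} (state : Fin n → Option (Fin n)) (c p : Fin n) :
    Fin n → Option (Fin n) :=
  match state p with
  | none => Function.update state p (some c)
  | some j =>
    match (List.finRange n).find? (fun k => decide (p < k) && (state k).isNone) with
    | none => Function.update state p (some c)
    | some k => Function.update (Function.update state p (some c)) k (some j)

/-- The final state of the MVP parking process with preference list `α`:
cars `0, 1, …, n-1` enter in order, car `i` preferring spot `α i`. -/
def mvpRun {n : ℕ} (α : Fin n → Fin n) : Fin n → Option (Fin n) :=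
  (List.finRange n).foldl (fun st c => mvpStep st c (α c)) (fun _ => none)

/-- `α` is an MVP parking function: under the MVP rule, all `n` cars end up parked. -/
def IsMVP {n : ℕ} (α : Fin n → Fin n) : Prop :=
  ∀ c : Fin n, ∃ j : Fin n, mvpRun α j = some c

/-- The outcome of the MVP parking process on `α` is the permutation `π`:
for each `j`, spot `j` ends up occupied by car `π j`. -/
def MvpOutcome {n : ℕ} (α : Fin n → Fin n) (π : Equiv.Perm (Fin n)) : Prop :=
  ∀ j : Fin n, mvpRun α j = some (π j)

end MVPPark

namespace MVPPark

/-- `m_j(α)`: the number of cars preferring spot `j` under the preference list `α`. -/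
def mcount {n : ℕ} (α : Fin n → Fin n) (j : Fin n) : ℕ :=
  (Finset.univ.filter (fun i => α i = j)).card

end MVPPark

namespace MVPPark

theorem mvpStep_self {n : ℕ} (st : Fin n → Option (Fin n)) (c p : Fin n) :
    mvpStep st c p p = some c := by
  unfold mvpStep
  rcases st p with _ | j
  · simp
  · dsimp only
    rcases hk : (List.finRange n).find? (fun k => decide (p < k) && (st k).isNone) with _ | k
    · simp
    · have hk' := List.find?_some hk
      simp only [Bool.and_eq_true, decide_eq_true_eq] at hk'
      simp [Function.update_of_ne hk'.1.ne]

/-- Away from the preferred spot, a step either changes nothing or fills the first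
unoccupied spot beyond `p` with the car bumped from `p`. -/
theorem mvpStep_of_ne {n : ℕ} (st : Fin n → Option (Fin n)) (c p : Fin n) {q : Fin n}
    (hq : q ≠ p) :
    mvpStep st c p q = st q ∨
      ∃ j, st p = some j ∧ mvpStep st c p q = some j ∧ st q = none ∧ p < q ∧
        ∀ r, p < r → r < q → st r ≠ none := by
  unfold mvpStep
  rcases hj : st p with _ | j
  · simp [hq]
  · dsimp only
    rcases hk : (List.finRange n).find? (fun k => decide (p < k) && (st k).isNone) with _ | k
    · simp [hq]
    · by_cases hqk : q = k
      · subst hqk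
        right
        rw [List.find?_eq_some_iff_getElem] at hk
        obtain ⟨h1, i, hi, hiq, hlt⟩ := hk
        simp only [Bool.and_eq_true, decide_eq_true_eq, Option.isNone_iff_eq_none] at h1
        refine ⟨j, rfl, by simp, h1.2, h1.1, fun r hpr hrq hr => ?_⟩
        have hiq' : i = q.1 := by simpa [Fin.ext_iff] using hiq
        have := hlt r.1 (by omega)
        simp [hpr, hr] at this
      · left
        simp [hqk, hq]

theorem mvpStep_of_eq_some {n : ℕ} {st : Fin n → Option (Fin n)} {c p q x : Fin n}
    (hq : q ≠ p) (h : st q = some x) : mvpStep st c p q = some x := by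
  rcases mvpStep_of_ne st c p hq with h' | ⟨j, -, -, h', -⟩
  · rw [h', h]
  · simp [h] at h'

theorem exists_of_mvpStep_eq_some {n : ℕ} {st : Fin n → Option (Fin n)} {c p q x : Fin n}
    (h : mvpStep st c p q = some x) (hx : x ≠ c) : ∃ r, st r = some x := by
  by_cases hq : q = p
  · subst hq
    rw [mvpStep_self] at h
    exact absurd (Option.some.inj h).symm hx
  · rcases mvpStep_of_ne st c p hq with h' | ⟨j, hj, h', -⟩
    · exact ⟨q, h' ▸ h⟩
    · exact ⟨p, by rw [hj, ← h', h]⟩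

/-- The state of the MVP parking process after the first `t` cars have entered. -/
def partialRun {n : ℕ} (α : Fin n → Fin n) : ℕ → Fin n → Option (Fin n)
  | 0 => fun _ => none
  | t + 1 => if ht : t < n then mvpStep (partialRun α t) ⟨t, ht⟩ (α ⟨t, ht⟩)
      else partialRun α t

theorem partialRun_succ {n : ℕ} (α : Fin n → Fin n) (c : Fin n) :
    partialRun α (c.1 + 1) = mvpStep (partialRun α c.1) c (α c) := by
  simp [partialRun]

theorem mvpRun_eq_partialRun {n : ℕ} (α : Fin n → Fin n) : mvpRun α = partialRun α n := by
  have key : ∀ t, t ≤ n → ((List.finRange n).take t).foldl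
      (fun st c => mvpStep st c (α c)) (fun _ => none) = partialRun α t := by
    intro t
    induction t with
    | zero => intro _; rfl
    | succ t ih =>
      intro ht
      rw [List.take_add_one, List.foldl_append, ih (by omega)]
      have : (List.finRange n)[t]? = some ⟨t, ht⟩ := by
        rw [List.getElem?_eq_some_iff]
        exact ⟨by simpa using ht, by simp⟩
      rw [this]
      simpa using (partialRun_succ α ⟨t, ht⟩).symm
  have := key n le_rfl
  rwa [List.take_of_length_le (by simp)] at this

/-- The invariants of the parking process after `t` cars have entered. -/
structure Invariant {n : ℕ} (α : Fin n → Fin n) (t : ℕ) (st : Fin n → Option (Fin n)) :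
    Prop where
  lt : ∀ p x, st p = some x → x.1 < t
  pref_le : ∀ p x, st p = some x → α x ≤ p
  inj : ∀ p q x, st p = some x → st q = some x → p = q
  occupied : ∀ p x, st p = some x → ∀ r, α x ≤ r → r ≤ p → st r ≠ none
  last : ∀ d : Fin n, d.1 < t → ∃ x, st (α d) = some x ∧ α x = α d ∧ d ≤ x

theorem Invariant.step {n : ℕ} {α : Fin n → Fin n} {c : Fin n}
    {st : Fin n → Option (Fin n)} (h : Invariant α c.1 st) :
    Invariant α (c.1 + 1) (mvpStep st c (α c)) := by
  have self := mvpStep_self st c (α c)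
  have keep : ∀ q, st q ≠ none → mvpStep st c (α c) q ≠ none := by
    intro q hq
    obtain ⟨x, hx⟩ := Option.ne_none_iff_exists'.1 hq
    by_cases hqp : q = α c
    · simp [hqp, self]
    · simp [mvpStep_of_eq_some hqp hx]
  have origin : ∀ q x, mvpStep st c (α c) q = some x →
      (q = α c ∧ x = c) ∨ (q ≠ α c ∧ st q = some x) ∨
      (st (α c) = some x ∧ st q = none ∧ α c < q ∧
        ∀ r, α c < r → r < q → st r ≠ none) := by
    intro q x hx
    by_cases hq : q = α c
    · subst hq
      rw [self] at hx
      exact Or.inl ⟨rfl, (Option.some.inj hx).symm⟩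
    · rcases mvpStep_of_ne st c (α c) hq with h' | ⟨j, hj, h', h1, h2, h3⟩
      · exact Or.inr (Or.inl ⟨hq, h' ▸ hx⟩)
      · rw [h'] at hx
        exact Or.inr (Or.inr ⟨hj.trans hx, h1, h2, h3⟩)
  refine ⟨?_, ?_, ?_, ?_, ?_⟩
  · intro p x hx
    rcases origin p x hx with ⟨-, rfl⟩ | ⟨-, h1⟩ | ⟨h1, -⟩
    · omega
    · have := h.lt _ _ h1; omega
    · have := h.lt _ _ h1; omega
  · intro p x hx
    rcases origin p x hx with ⟨rfl, rfl⟩ | ⟨-, h1⟩ | ⟨h1, -, h2, -⟩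
    · exact le_rfl
    · exact h.pref_le _ _ h1
    · exact (h.pref_le _ _ h1).trans h2.le
  · intro p q x hp hq
    have hc : ∀ r, st r ≠ some c := fun r hr => absurd (h.lt _ _ hr) (lt_irrefl _)
    rcases origin p x hp with ⟨rfl, rfl⟩ | ⟨h0, h1⟩ | ⟨h1, h2, h3, h4⟩ <;>
      rcases origin q x hq with ⟨rfl, h1'⟩ | ⟨h0', h1'⟩ | ⟨h1', h2', h3', h4'⟩
    · rfl
    · exact absurd h1' (hc _)
    · exact absurd h1' (hc _)
    · subst h1'; exact absurd h1 (hc _)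
    · exact h.inj _ _ _ h1 h1'
    · exact absurd (h.inj _ _ _ h1 h1') h0
    · subst h1'; exact absurd h1 (hc _)
    · exact absurd (h.inj _ _ _ h1' h1) h0'
    · rcases lt_trichotomy p q with hlt | heq | hlt
      · exact absurd h2 (h4' _ h3 hlt)
      · exact heq
      · exact absurd h2' (h4 _ h3' hlt)
  · intro p x hx r hr hrp
    rcases origin p x hx with ⟨rfl, rfl⟩ | ⟨-, h1⟩ | ⟨h1, -, h2, h3⟩
    · rw [le_antisymm hrp hr, self]; simp
    · exact keep r (h.occupied _ _ h1 r hr hrp)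
    · rcases le_or_gt r (α c) with hrc | hrc
      · exact keep r (h.occupied _ _ h1 r hr hrc)
      · rcases hrp.lt_or_eq with hlt | rfl
        · exact keep r (h3 r hrc hlt)
        · rw [hx]; simp
  · intro d hd
    by_cases hdc : α d = α c
    · exact ⟨c, by rw [hdc, self], hdc.symm, Fin.le_def.2 (by omega)⟩
    · have hne : d.1 ≠ c.1 := fun e => hdc (by rw [Fin.ext e])
      obtain ⟨x, h1, h2, h3⟩ := h.last d (by omega)
      exact ⟨x, mvpStep_of_eq_some hdc h1, h2, h3⟩

theorem invariant_partialRun {n : ℕ} (α : Fin n → Fin n) {t : ℕ} (ht : t ≤ n) :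
    Invariant α t (partialRun α t) := by
  induction t with
  | zero => constructor <;> simp [partialRun]
  | succ t ih =>
    rw [partialRun_succ α ⟨t, ht⟩]
    exact Invariant.step (c := ⟨t, ht⟩) (ih (by omega))

/-- A car parked at the end is parked at all times after its arrival. -/
theorem exists_partialRun_eq_some {n : ℕ} {α : Fin n → Fin n} {x : Fin n} {t : ℕ}
    (hxt : x.1 < t) (htn : t ≤ n) (hx : ∃ p, partialRun α n p = some x) :
    ∃ p, partialRun α t p = some x := by
  induction htn using Nat.decreasingInduction with
  | self => exact hx
  | of_succ t ht ih =>
    obtain ⟨p, hp⟩ := ih (by omega)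
    rw [partialRun_succ α ⟨t, ht⟩] at hp
    exact exists_of_mvpStep_eq_some hp (fun e => by simp [e] at hxt)

/-- A parked car is not moved while no entering car prefers its spot. -/
theorem partialRun_eq_some_of_le {n : ℕ} {α : Fin n → Fin n} {p x : Fin n} {t u : ℕ}
    (hp : partialRun α t p = some x) (htu : t ≤ u) (hu : u ≤ n)
    (hne : ∀ d : Fin n, t ≤ d.1 → α d ≠ p) : partialRun α u p = some x := by
  induction u, htu using Nat.le_induction with
  | base => exact hp
  | succ u htu ih =>
    rw [partialRun_succ α ⟨u, hu⟩]
    exact mvpStep_of_eq_some (hne ⟨u, hu⟩ htu).symm (ih (by omega))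

theorem pref_le_rev {n : ℕ} {α : Fin n → Fin n}
    (h : ∀ j : Fin n, mvpRun α j = some j.rev) (c : Fin n) : α c ≤ c.rev := by
  refine (invariant_partialRun α le_rfl).pref_le _ _ ?_
  rw [← mvpRun_eq_partialRun, h, Fin.rev_rev]

/-- If the outcome is decreasing, then no spot is preferred by three cars. -/
theorem mcount_le_two {n : ℕ} {α : Fin n → Fin n}
    (h : ∀ j : Fin n, mvpRun α j = some j.rev) (k : Fin n) : mcount α k ≤ 2 := by
  have hfin : ∀ j, partialRun α n j = some j.rev := by
    rw [← mvpRun_eq_partialRun]; exact h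
  have hpark : ∀ x, ∃ p, partialRun α n p = some x := fun x => ⟨x.rev, by rw [hfin]; simp⟩
  by_contra! hk
  set c₃ := k.rev with hc₃
  have hle : ∀ d, α d = k → d ≤ c₃ := by
    rintro d rfl
    exact Fin.le_rev_iff.2 (pref_le_rev h d)
  have hpref : α c₃ = k := by
    obtain ⟨d, hd⟩ := Finset.card_pos.1 (show 0 < mcount α k by omega)
    have hd : α d = k := by simpa using hd
    obtain ⟨x, h1, h2, -⟩ := (invariant_partialRun α le_rfl).last d d.2
    rw [hd, hfin] at h1
    rw [hc₃, Option.some.inj h1, h2, hd]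
  have hcard : 1 < ((Finset.univ.filter (fun i => α i = k)).erase c₃).card := by
    rw [Finset.card_erase_of_mem (by simp [hpref])]
    unfold mcount at hk
    omega
  have hS : ∀ d, d ∈ (Finset.univ.filter (fun i => α i = k)).erase c₃ → α d = k ∧ d < c₃ := by
    intro d hd
    simp only [Finset.mem_erase, Finset.mem_filter, Finset.mem_univ, true_and] at hd
    exact ⟨hd.2, lt_of_le_of_ne (hle d hd.2) hd.1⟩
  have hinv := invariant_partialRun α c₃.2.le
  obtain ⟨d, hd, -⟩ := Finset.one_lt_card.1 hcard
  obtain ⟨c₂, hc₂, hαc₂, -⟩ := hinv.last d (hS d hd).2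
  rw [(hS d hd).1] at hc₂ hαc₂
  obtain ⟨c₁, hc₁, hne⟩ := Finset.exists_mem_ne hcard c₂
  obtain ⟨hαc₁, hlt₁⟩ := hS c₁ hc₁
  have hlt₂ : c₂ < c₃ := hinv.lt _ _ hc₂
  have h12 : c₁ < c₂ := by
    obtain ⟨x, hx, -, hx'⟩ := hinv.last c₁ hlt₁
    rw [hαc₁, hc₂] at hx
    exact lt_of_le_of_ne (Option.some.inj hx ▸ hx') hne
  obtain ⟨p₁, hp₁⟩ := exists_partialRun_eq_some hlt₁ c₃.2.le (hpark c₁)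
  have hkp₁ : k < p₁ := by
    refine lt_of_le_of_ne (hαc₁ ▸ hinv.pref_le _ _ hp₁) ?_
    rintro rfl
    rw [hc₂] at hp₁
    exact hne (Option.some.inj hp₁).symm
  obtain ⟨p₂, hp₂⟩ := exists_partialRun_eq_some (t := c₃.1 + 1) (lt_trans hlt₂ (Nat.lt_succ_self _))
    c₃.2 (hpark c₂)
  have hp₁' : partialRun α (c₃.1 + 1) p₁ = some c₁ := by
    rw [partialRun_succ, hpref]
    exact mvpStep_of_eq_some hkp₁.ne' hp₁
  have hp₂' := hp₂
  rw [partialRun_succ, hpref] at hp₂'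
  have hp₂k : p₂ ≠ k := by
    rintro rfl
    rw [mvpStep_self] at hp₂'
    exact hlt₂.ne' (Option.some.inj hp₂')
  have hp12 : k < p₂ ∧ p₁ < p₂ := by
    rcases mvpStep_of_ne (partialRun α c₃.1) c₃ k hp₂k with h' | ⟨j, -, -, hnone, hkp₂, -⟩
    · exact absurd (hinv.inj _ _ _ (h' ▸ hp₂') hc₂) hp₂k
    · refine ⟨hkp₂, lt_of_not_ge fun hge => ?_⟩
      exact hinv.occupied _ _ hp₁ p₂ (hαc₁ ▸ hkp₂.le) hge hnone
  have hstay : ∀ p, k < p → ∀ d : Fin n, c₃.1 + 1 ≤ d.1 → α d ≠ p := by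
    rintro p hkp d hd rfl
    have h1 : d ≤ (α d).rev := Fin.le_rev_iff.2 (pref_le_rev h d)
    have h2 : (α d).rev < c₃ := Fin.rev_lt_rev.2 hkp
    have := h1.trans_lt h2
    exact absurd hd (by omega)
  have e₁ := partialRun_eq_some_of_le hp₁' c₃.2 le_rfl (hstay p₁ hkp₁)
  have e₂ := partialRun_eq_some_of_le hp₂ c₃.2 le_rfl (hstay p₂ hp12.1)
  rw [hfin] at e₁ e₂
  rw [← Option.some.inj e₁, ← Option.some.inj e₂, Fin.rev_lt_rev] at h12
  exact lt_asymm h12 hp12.2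

/-- If the outcome is decreasing, then at least `i` cars prefer one of the first `i` spots. -/
theorem le_sum_mcount {n : ℕ} {α : Fin n → Fin n}
    (h : ∀ j : Fin n, mvpRun α j = some j.rev) (i : ℕ) :
    (Finset.univ.filter (fun j : Fin n => j.1 < i)).card ≤
      ∑ j ∈ Finset.univ.filter (fun j : Fin n => j.1 < i), mcount α j := by
  have hsum : ∑ j ∈ Finset.univ.filter (fun j : Fin n => j.1 < i), mcount α j =
      (Finset.univ.filter (fun c : Fin n => (α c).1 < i)).card := by
    rw [Finset.card_eq_sum_card_fiberwise (f := α)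
      (t := Finset.univ.filter (fun j : Fin n => j.1 < i)) (fun c hc => by simpa using hc)]
    refine Finset.sum_congr rfl fun j hj => ?_
    unfold mcount
    congr 1
    ext c
    simp only [Finset.mem_filter, Finset.mem_univ, true_and] at hj ⊢
    exact ⟨fun e => ⟨e ▸ hj, e⟩, fun e => e.2⟩
  rw [hsum]
  refine Finset.card_le_card_of_injOn Fin.rev (fun j hj => ?_) Fin.rev_injective.injOn
  have hle : (α j.rev).1 ≤ j.1 := by simpa using Fin.le_def.1 (pref_le_rev h j.rev)
  have hj : j.1 < i := by simpa using hj
  simpa using hle.trans_lt hj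

end MVPPark

open MVPPark in
/-- If the outcome of `α` is the decreasing permutation `w₀`, then among the first `i`
spots, the number of spots preferred by at least two cars is at least the number of
spots preferred by no car. -/
theorem up_ge_down_prefix (n : ℕ) (hn : 1 ≤ n) (α : Fin n → Fin n)
    (h : ∀ j : Fin n, mvpRun α j = some j.rev) :
    ∀ i : ℕ, 1 ≤ i → i ≤ n →
      (Finset.univ.filter (fun j : Fin n => j.1 < i ∧ mcount α j = 0)).card ≤
        (Finset.univ.filter (fun j : Fin n => j.1 < i ∧ 2 ≤ mcount α j)).card := by
  intro i _ _
  have hle := le_sum_mcount h i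
  have hpt : ∑ j ∈ Finset.univ.filter (fun j : Fin n => j.1 < i),
        (mcount α j + if mcount α j = 0 then 1 else 0) ≤
      ∑ j ∈ Finset.univ.filter (fun j : Fin n => j.1 < i),
        (1 + if 2 ≤ mcount α j then 1 else 0) := by
    refine Finset.sum_le_sum fun j _ => ?_
    have := mcount_le_two h j
    split_ifs <;> omega
  rw [Finset.sum_add_distrib, Finset.sum_add_distrib, ← Finset.card_eq_sum_ones,
    ← Finset.card_filter, ← Finset.card_filter, Finset.filter_filter,
    Finset.filter_filter] at hpt
  omega
end

section
/- Let n ≥ 1 and let α = (a_1,…,a_n) be an MVP parking function with O_n(α) = w_0. Then for every i ∈ [n], among the last i spots n−i+1,…,n, the number of spots preferred by no car is at least the number of spots preferred by at least two cars: |{j > n−i : m_j(α) = 0}| ≥ |{j > n−i : m_j(α) ≥ 2}|. -/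
open Finset

namespace MVPPark

/-- If every parked car is at or beyond its preference, this persists after one parking step. -/
theorem pref_le_mvpStep {n : ℕ} (α : Fin n → Fin n) (state : Fin n → Option (Fin n))
    (hs : ∀ j c, state j = some c → α c ≤ j) (d : Fin n) :
    ∀ j c, mvpStep state d (α d) j = some c → α c ≤ j := by
  have hupd : ∀ j c, Function.update state (α d) (some d) j = some c → α c ≤ j := by
    intro j c hc
    rw [Function.update_apply] at hc
    split_ifs at hc with hj
    · cases hc
      exact hj.ge
    · exact hs j c hc
  intro j c hc
  unfold mvpStep at hc
  rcases hb : state (α d) with _ | b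
  · rw [hb] at hc
    exact hupd j c hc
  · rw [hb] at hc
    rcases hk : (List.finRange n).find? (fun k => decide (α d < k) && (state k).isNone) with _ | k
    · simp only [hk] at hc
      exact hupd j c hc
    · simp only [hk] at hc
      have hk' := List.find?_some hk
      simp only [Bool.and_eq_true, decide_eq_true_eq] at hk'
      rw [Function.update_apply] at hc
      split_ifs at hc with hj
      · cases hc
        exact (hs _ _ hb).trans (hk'.1.le.trans hj.ge)
      · exact hupd j c hc

/-- Every car ends up parked at or beyond its preferred spot. -/
theorem pref_le_of_mvpRun_eq_some {n : ℕ} (α : Fin n → Fin n) :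
    ∀ j c, mvpRun α j = some c → α c ≤ j := by
  unfold mvpRun
  refine List.foldlRecOn (motive := fun st : Fin n → Option (Fin n) =>
    ∀ j c, st j = some c → α c ≤ j) _ _ (by simp) ?_
  intro st hst c _
  exact pref_le_mvpStep α st hst c

/-- If the preferences falling in a set of spots are at most as many as its spots, then it has
at least as many spots preferred by no car as spots preferred by at least two cars. -/
theorem card_two_le_mcount_le_card_mcount_eq_zero {n : ℕ} (α : Fin n → Fin n)
    (s : Finset (Fin n)) (hs : (univ.filter fun c => α c ∈ s).card ≤ s.card) :
    (s.filter fun j => 2 ≤ mcount α j).card ≤ (s.filter fun j => mcount α j = 0).card := by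
  have hsum : ∑ j ∈ s, mcount α j = (univ.filter fun c => α c ∈ s).card := by
    rw [card_eq_sum_card_fiberwise (f := α) (t := s) (by intro c hc; simpa using hc)]
    refine sum_congr rfl fun j hj => ?_
    unfold mcount
    congr 1
    ext c
    simp only [mem_filter, mem_univ, true_and]
    exact ⟨fun hc => ⟨hc ▸ hj, hc⟩, fun hc => hc.2⟩
  have hle : ∑ j ∈ s, (1 + if 2 ≤ mcount α j then 1 else 0) ≤
      ∑ j ∈ s, (mcount α j + if mcount α j = 0 then 1 else 0) := by
    refine sum_le_sum fun j _ => ?_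
    split_ifs <;> omega
  simp only [sum_add_distrib, ← card_filter, sum_const, smul_eq_mul, mul_one] at hle
  omega

end MVPPark

open MVPPark in
/-- If the outcome of `α` is the decreasing permutation `w₀`, then among the last `i`
spots, the number of spots preferred by no car is at least the number of spots
preferred by at least two cars. -/
theorem down_ge_up_suffix (n : ℕ) (hn : 1 ≤ n) (α : Fin n → Fin n)
    (h : ∀ j : Fin n, mvpRun α j = some j.rev) :
    ∀ i : ℕ, 1 ≤ i → i ≤ n →
      (Finset.univ.filter (fun j : Fin n => n - i ≤ j.1 ∧ 2 ≤ mcount α j)).card ≤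
        (Finset.univ.filter (fun j : Fin n => n - i ≤ j.1 ∧ mcount α j = 0)).card := by
  intro i _ _
  rw [← filter_filter, ← filter_filter]
  refine card_two_le_mcount_le_card_mcount_eq_zero α _ ?_
  refine card_le_card_of_injOn Fin.rev ?_ Fin.rev_injective.injOn
  intro c hc
  have hle : α c ≤ c.rev := by
    refine pref_le_of_mvpRun_eq_some α c.rev c ?_
    rw [h, Fin.rev_rev]
  simp only [coe_filter, mem_filter, mem_univ, true_and, Set.mem_ofPred_eq] at hc ⊢
  exact hc.trans hle
end
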